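/- Let 0 < α < n and let I_α be the Riesz potential I_α f(x) = ∫_{ℝⁿ} |x−y|^{α−n} f(y) dy. Let p : ℝⁿ → (0,∞) satisfy the local log-Hölder condition and the log-Hölder condition at infinity with 0 < p₋ ≤ p₊ < n/α, define q by 1/q(x) = 1/p(x) − α/n, let max(1,p₊) < p₀ < n/α, 1/q₀ = 1/p₀ − α/n, and let d ≥ d_{p(·)} be an integer. Then there is a constant C, independent of the atom, such that for every (p(·),p₀,d)-atom a supported in a cube Q, ‖I_α a‖_{L^{q₀}(2√n Q)} ≤ C |Q|^{1/q₀} / ‖χ_Q‖_{q(·)}. -/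

import Mathlib

open MeasureTheory ENNReal

noncomputable section

abbrev Rn (n : ℕ) := EuclideanSpace ℝ (Fin n)

/-- The variable exponent Lebesgue quasinorm of an `ℝ≥0∞`-valued function. -/
def varLpNormE {n : ℕ} (p : Rn n → ℝ) (g : Rn n → ℝ≥0∞) : ℝ≥0∞ :=
  sInf {l : ℝ≥0∞ | ∃ lam : ℝ, 0 < lam ∧ l = ENNReal.ofReal lam ∧
    (∫⁻ x, (g x / ENNReal.ofReal lam) ^ (p x)) ≤ 1}

/-- The variable exponent Lebesgue quasinorm `‖f‖_{p(·)}`. -/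
def varLpNorm {n : ℕ} (p : Rn n → ℝ) (f : Rn n → ℝ) : ℝ≥0∞ :=
  varLpNormE p (fun x => ENNReal.ofReal |f x|)

/-- The local log-Hölder continuity condition. -/
def LogHolderLocal {n : ℕ} (p : Rn n → ℝ) : Prop :=
  ∃ c > 0, ∀ x y : Rn n, ‖x - y‖ < 1/2 → |p x - p y| ≤ c / (-Real.log ‖x - y‖)

/-- The log-Hölder condition at infinity. -/
def LogHolderInfty {n : ℕ} (p : Rn n → ℝ) : Prop :=
  ∃ C > 0, ∃ pinf : ℝ, ∀ x : Rn n, |p x - pinf| ≤ C / Real.log (Real.exp 1 + ‖x‖)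

/-- The (closed) cube centered at `z` with side length `r`. -/
def cube {n : ℕ} (z : Rn n) (r : ℝ) : Set (Rn n) := {x | ∀ i, |x i - z i| ≤ r / 2}

/-- The characteristic function of the cube `Q(z,r)`. -/
def cubeInd {n : ℕ} (z : Rn n) (r : ℝ) : Rn n → ℝ := Set.indicator (cube z r) 1

/-- The fractional maximal operator `M_β`. -/
def fracMax {n : ℕ} (β : ℝ) (f : Rn n → ℝ) (x : Rn n) : ℝ :=
  ⨆ (z : Rn n) (r : ℝ) (_ : 0 < r) (_ : x ∈ cube z r),
    (volume (cube z r)).toReal ^ (β / (n : ℝ) - 1) * ∫ y in cube z r, |f y|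

/-- `p̲ = min (p₋, 1)`. -/
def pUnder {n : ℕ} (p : Rn n → ℝ) : ℝ := min (⨅ x, p x) 1

/-- The quantity `𝒜({λ_j},{Q_j},p(·))`. -/
def AFun {n : ℕ} (p : Rn n → ℝ) (lam : ℕ → ℝ) (z : ℕ → Rn n) (r : ℕ → ℝ) : ℝ≥0∞ :=
  varLpNorm p (fun x =>
    (∑' j, (lam j * cubeInd (z j) (r j) x /
        (varLpNorm p (cubeInd (z j) (r j))).toReal) ^ pUnder p) ^ (1 / pUnder p))

/-- `d_{p(·)} = min {ℓ ∈ ℕ : p₋ (n + ℓ + 1) > n}` where `t` plays the role of `p₋`. -/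
def dIndex (n : ℕ) (t : ℝ) : ℕ := sInf {l : ℕ | t * (n + l + 1) > n}

/-- `p₋`, the essential lower bound of the exponent. -/
def pLow {n : ℕ} (p : Rn n → ℝ) : ℝ := ⨅ x, p x

/-- A `(p(·), p₀, d)`-atom supported in the cube `Q(z,r)`. -/
structure IsPAtom {n : ℕ} (p : Rn n → ℝ) (p₀ : ℝ) (d : ℕ) (a : Rn n → ℝ)
    (z : Rn n) (r : ℝ) : Prop where
  measurable : Measurable a
  support : ∀ x, x ∉ cube z r → a x = 0
  size : eLpNorm a (ENNReal.ofReal p₀) volume ≤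
    ENNReal.ofReal ((volume (cube z r)).toReal ^ (1 / p₀)) / varLpNorm p (cubeInd z r)
  moments : ∀ γ : Fin n → ℕ, (∑ i, γ i) ≤ d → ∫ x, a x * ∏ i, x i ^ γ i = 0

/-- Action of an `n × n` matrix on `ℝⁿ`. -/
def mApp {n : ℕ} (A : Matrix (Fin n) (Fin n) ℝ) (x : Rn n) : Rn n :=
  Matrix.toEuclideanLin A x

/-- The operator norm of a matrix acting on Euclidean space. -/
def opNorm {n : ℕ} (A : Matrix (Fin n) (Fin n) ℝ) : ℝ :=
  ‖Matrix.toEuclideanCLM (𝕜 := ℝ) A‖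

/-- The kernel `k(x,y) = |x - A₁ y|^{-α₁} ⋯ |x - A_m y|^{-α_m}`. -/
def kern {n m : ℕ} (A : Fin m → Matrix (Fin n) (Fin n) ℝ) (αe : Fin m → ℝ)
    (x y : Rn n) : ℝ :=
  ∏ i, ‖x - mApp (A i) y‖ ^ (-(αe i))

/-- The fractional type integral operator `T_α`. -/
def Tα {n m : ℕ} (A : Fin m → Matrix (Fin n) (Fin n) ℝ) (αe : Fin m → ℝ)
    (f : Rn n → ℝ) (x : Rn n) : ℝ :=
  ∫ y, kern A αe x y * f y

/-- The Riesz potential `I_α`. -/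
def riesz {n : ℕ} (α : ℝ) (f : Rn n → ℝ) (x : Rn n) : ℝ :=
  ∫ y, ‖x - y‖ ^ (α - (n : ℝ)) * f y

/-- Partial derivative in the `i`-th coordinate direction. -/
def pderiv1 {n : ℕ} (i : Fin n) (g : Rn n → ℝ) : Rn n → ℝ :=
  fun x => fderiv ℝ g x (EuclideanSpace.single i 1)

/-- The multiindex partial derivative `∂^γ`. -/
def mderiv {n : ℕ} (γ : Fin n → ℕ) (g : Rn n → ℝ) : Rn n → ℝ :=
  (List.finRange n).foldr (fun i h => (pderiv1 i)^[γ i] h) g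

/-- The finite set of multiindices `γ` with `|γ| ≤ N`. -/
def multiIndices (n N : ℕ) : Finset (Fin n → ℕ) :=
  (Fintype.piFinset fun _ => Finset.range (N+1)).filter (fun γ => (∑ i, γ i) ≤ N)

/-- The family `F_N` of normalized Schwartz test functions. -/
def FN (n N : ℕ) : Set (SchwartzMap (Rn n) ℝ) :=
  {φ | (∑ γ ∈ multiIndices n N, ⨆ x : Rn n, (1 + ‖x‖) ^ N * |mderiv γ (⇑φ) x|) ≤ 1}

/-- The grand maximal function `𝓜 f`. -/
def grandMax (n N : ℕ) (f : Rn n → ℝ) (x : Rn n) : ℝ≥0∞ :=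
  ⨆ (t : ℝ) (_ : 0 < t) (φ : FN n N),
    ENNReal.ofReal |∫ y, t ^ (-(n : ℝ)) * (φ : SchwartzMap (Rn n) ℝ) (t⁻¹ • (x - y)) * f y|

/-- The variable Hardy space quasinorm `‖f‖_{H^{p(·)}}` (with parameter `N`). -/
def hardyNorm {n : ℕ} (p : Rn n → ℝ) (N : ℕ) (f : Rn n → ℝ) : ℝ≥0∞ :=
  varLpNormE p (grandMax n N f)

/-- `γ! = γ₁! ⋯ γ_n!`. -/
def mfact {n : ℕ} (γ : Fin n → ℕ) : ℕ := ∏ i, (γ i).factorial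

/-- The degree-`d` Taylor polynomial of `g` at `z`, evaluated at `y`. -/
def taylorPoly {n : ℕ} (d : ℕ) (g : Rn n → ℝ) (z y : Rn n) : ℝ :=
  ∑ γ ∈ multiIndices n d, (mderiv γ g z / (mfact γ : ℝ)) * ∏ i, (y i - z i) ^ γ i

end

lemma aux_layer (b : ℝ) (hb : 0 < b) (Y : ℝ≥0∞) :
    ∫⁻ t in Set.Ioi (0:ℝ), Set.indicator {t : ℝ | ENNReal.ofReal t < Y}
      (fun t => ENNReal.ofReal (t ^ (b - 1))) t = Y ^ b / ENNReal.ofReal b := by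
  have key : ∀ M : ℝ, 0 ≤ M → ∫⁻ t in Set.Ioi (0:ℝ), Set.indicator {t : ℝ | t < M}
      (fun t => ENNReal.ofReal (t ^ (b - 1))) t = ENNReal.ofReal M ^ b / ENNReal.ofReal b := by
    intro M hM
    have hm : MeasurableSet {t : ℝ | t < M} := measurableSet_Iio
    rw [lintegral_indicator hm, Measure.restrict_restrict hm]
    have hset : {t : ℝ | t < M} ∩ Set.Ioi 0 = Set.Ioo 0 M := by
      ext t; simp [and_comm]
    rw [hset]
    have hint : IntegrableOn (fun t : ℝ => t ^ (b - 1)) (Set.Ioo 0 M) := by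
      have := (intervalIntegral.intervalIntegrable_rpow' (a := 0) (b := M) (r := b - 1) (by linarith))
      rw [intervalIntegrable_iff_integrableOn_Ioo_of_le hM] at this
      exact this
    rw [← ofReal_integral_eq_lintegral_ofReal hint]
    · rw [← integral_Ioc_eq_integral_Ioo, ← intervalIntegral.integral_of_le hM,
        integral_rpow (Or.inl (by linarith))]
      rw [Real.zero_rpow (by linarith), ENNReal.ofReal_rpow_of_nonneg hM hb.le,
        ← ENNReal.ofReal_div_of_pos hb]
      simp
    · filter_upwards [ae_restrict_mem measurableSet_Ioo] with t ht
      exact Real.rpow_nonneg ht.1.le _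
  rcases eq_or_ne Y ⊤ with rfl | hY
  · rw [ENNReal.top_rpow_of_pos hb, ENNReal.top_div_of_ne_top ENNReal.ofReal_ne_top]
    refine ENNReal.eq_top_of_forall_nnreal_le fun r => ?_
    have h1 := key ((b * r) ^ (1 / b)) (by positivity)
    have h2 : ENNReal.ofReal ((b * r) ^ (1 / b)) ^ b / ENNReal.ofReal b = r := by
      rw [ENNReal.ofReal_rpow_of_nonneg (by positivity) hb.le, ← ENNReal.ofReal_div_of_pos hb,
        ← Real.rpow_mul (by positivity)]
      rw [one_div_mul_cancel hb.ne', Real.rpow_one, mul_div_cancel_left₀ _ hb.ne']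
      simp
    rw [← h2, ← h1]
    refine lintegral_mono fun t => ?_
    refine Set.indicator_le_indicator_of_subset (fun t ht => ?_) (fun _ => zero_le) t
    simp
  · rw [show Y = ENNReal.ofReal Y.toReal from (ENNReal.ofReal_toReal hY).symm,
      ← key _ ENNReal.toReal_nonneg]
    refine setLIntegral_congr_fun measurableSet_Ioi fun t ht => ?_
    have ht' : (0:ℝ) < t := ht
    have : (ENNReal.ofReal t < ENNReal.ofReal Y.toReal) ↔ t < Y.toReal := by
      rw [ENNReal.ofReal_lt_ofReal_iff_of_nonneg ht'.le]
    simp only [Set.indicator, Set.mem_ofPred_eq, this]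

lemma aux_radial {n : ℕ} (hn : 0 < n) (f : ℝ → ℝ) (hf : ∀ y, 0 ≤ y → 0 ≤ f y)
    (hint : IntegrableOn (fun y : ℝ => y ^ (n - 1) * f y) (Set.Ioi 0)) :
    ∫⁻ x : Rn n, ENNReal.ofReal (f ‖x‖) = ENNReal.ofReal
      (n * (volume.real (Metric.ball (0 : Rn n) 1) * ∫ y in Set.Ioi (0:ℝ), y ^ (n - 1) * f y)) := by
  have : Nonempty (Fin n) := ⟨⟨0, hn⟩⟩
  have h1 : Integrable (fun x : Rn n => f ‖x‖) := by
    rw [integrable_fun_norm_addHaar]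
    simpa using hint
  rw [← ofReal_integral_eq_lintegral_ofReal h1 (Filter.Eventually.of_forall fun x => hf _ (norm_nonneg _)),
    integral_fun_norm_addHaar]
  simp

lemma aux_pow_mul {n : ℕ} (hn : 0 < n) (β y : ℝ) (hy : 0 < y) :
    y ^ (n - 1) * y ^ β = y ^ (β + n - 1) := by
  rw [← Real.rpow_natCast, ← Real.rpow_add hy]
  congr 1
  rw [Nat.cast_sub hn]; push_cast; ring

lemma kern_in {n : ℕ} (hn : 0 < n) (β : ℝ) (hβ : 0 < β + n) :
    ∃ c : ℝ, 0 ≤ c ∧ ∀ R : ℝ, 0 < R →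
      ∫⁻ x : Rn n, ENNReal.ofReal (Set.indicator (Set.Iic R) (fun y => y ^ β) ‖x‖)
        ≤ ENNReal.ofReal (c * R ^ (β + n)) := by
  refine ⟨n * volume.real (Metric.ball (0 : Rn n) 1) / (β + n), by positivity, fun R hR => ?_⟩
  have e : Set.EqOn (fun y : ℝ => y ^ (n - 1) * Set.indicator (Set.Iic R) (fun y => y ^ β) y)
      (Set.indicator (Set.Iic R) (fun y : ℝ => y ^ (β + n - 1))) (Set.Ioi 0) := by
    intro y hy
    by_cases h : y ∈ Set.Iic R
    · simp only [Set.indicator_of_mem h]; exact aux_pow_mul hn β y hy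
    · simp only [Set.indicator_of_notMem h, mul_zero]
  have hI : IntegrableOn (fun t : ℝ => t ^ (β + n - 1)) (Set.Ioc 0 R) := by
    have := (intervalIntegral.intervalIntegrable_rpow' (a := 0) (b := R) (r := β + n - 1) (by linarith))
    rwa [intervalIntegrable_iff_integrableOn_Ioc_of_le hR.le] at this
  have hs : Set.Ioi (0:ℝ) ∩ Set.Iic R = Set.Ioc 0 R := rfl
  have hs' : Set.Iic R ∩ Set.Ioi (0:ℝ)  = Set.Ioc 0 R := by rw [Set.inter_comm]; rfl
  rw [aux_radial hn]
  · rw [setIntegral_congr_fun measurableSet_Ioi e, setIntegral_indicator measurableSet_Iic, hs,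
      ← intervalIntegral.integral_of_le hR.le, integral_rpow (Or.inl (by linarith))]
    rw [Real.zero_rpow (by linarith)]
    refine le_of_eq ?_
    congr 1
    rw [sub_add_cancel, sub_zero]; ring
  · intro y hy
    exact Set.indicator_apply_nonneg (fun _ => Real.rpow_nonneg hy _)
  · rw [integrableOn_congr_fun e measurableSet_Ioi, IntegrableOn, integrable_indicator_iff measurableSet_Iic,
      IntegrableOn, Measure.restrict_restrict measurableSet_Iic, hs']
    exact hI

lemma kern_out {n : ℕ} (hn : 0 < n) (β : ℝ) (hβ : β + n < 0) :
    ∃ c : ℝ, 0 ≤ c ∧ ∀ R : ℝ, 0 < R →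
      ∫⁻ x : Rn n, ENNReal.ofReal (Set.indicator (Set.Ioi R) (fun y => y ^ β) ‖x‖)
        ≤ ENNReal.ofReal (c * R ^ (β + n)) := by
  refine ⟨n * volume.real (Metric.ball (0 : Rn n) 1) / (-(β + n)), 
    div_nonneg (by positivity) (by linarith), fun R hR => ?_⟩
  have e : Set.EqOn (fun y : ℝ => y ^ (n - 1) * Set.indicator (Set.Ioi R) (fun y => y ^ β) y)
      (Set.indicator (Set.Ioi R) (fun y : ℝ => y ^ (β + n - 1))) (Set.Ioi 0) := by
    intro y hy
    by_cases h : y ∈ Set.Ioi R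
    · simp only [Set.indicator_of_mem h]; exact aux_pow_mul hn β y hy
    · simp only [Set.indicator_of_notMem h, mul_zero]
  have hI : IntegrableOn (fun t : ℝ => t ^ (β + n - 1)) (Set.Ioi R) :=
    integrableOn_Ioi_rpow_of_lt (by linarith) hR
  have hs' : Set.Ioi R ∩ Set.Ioi (0:ℝ)  = Set.Ioi R := by
    rw [Set.inter_eq_left]; exact Set.Ioi_subset_Ioi hR.le
  have hs : Set.Ioi (0:ℝ) ∩ Set.Ioi R = Set.Ioi R := by rw [Set.inter_comm, hs']
  rw [aux_radial hn]
  · rw [setIntegral_congr_fun measurableSet_Ioi e, setIntegral_indicator measurableSet_Ioi, hs,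
      integral_Ioi_rpow_of_lt (by linarith) hR]
    refine le_of_eq ?_
    congr 1
    rw [sub_add_cancel, div_neg]; ring
  · intro y hy
    exact Set.indicator_apply_nonneg (fun _ => Real.rpow_nonneg hy _)
  · rw [integrableOn_congr_fun e measurableSet_Ioi, IntegrableOn, integrable_indicator_iff measurableSet_Ioi,
      IntegrableOn, Measure.restrict_restrict measurableSet_Ioi, hs']
    exact hI

lemma marcin_aux {n : ℕ} (p q c : ℝ) (hp : 1 < p) (hq : 0 < q) (hc : 0 ≤ c)
    (T f : Rn n → ℝ≥0∞) (hT : Measurable T) (hf : Measurable f)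
    (H : ∀ t : ℝ, 0 < t → volume {x | ENNReal.ofReal t < T x} ≤
      ENNReal.ofReal (c * t ^ (-(q / p))) *
        ∫⁻ x, Set.indicator {x | ENNReal.ofReal (t ^ (q / p)) < f x} f x) :
    ∫⁻ x, T x ^ q ≤ ENNReal.ofReal (q * c / (q - q / p)) * ∫⁻ x, f x ^ p := by
  have hp0 : 0 < p := by linarith
  have hb : 0 < q - q / p := by
    rw [sub_pos, div_lt_iff₀ hp0]; nlinarith
  set b := q - q / p with hbdef
  have e1 : ∀ x, T x ^ q = ENNReal.ofReal q * ∫⁻ t in Set.Ioi (0:ℝ),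
      Set.indicator {t : ℝ | ENNReal.ofReal t < T x} (fun t => ENNReal.ofReal (t ^ (q - 1))) t := by
    intro x
    rw [aux_layer q hq, ENNReal.mul_div_cancel (by simpa using hq) ENNReal.ofReal_ne_top]
  have mT : Measurable (Function.uncurry fun (x : Rn n) (t : ℝ) =>
      Set.indicator {t : ℝ | ENNReal.ofReal t < T x} (fun t => ENNReal.ofReal (t ^ (q - 1))) t) := by
    have hs : MeasurableSet {z : Rn n × ℝ | ENNReal.ofReal z.2 < T z.1} :=
      measurableSet_lt (by fun_prop) (by fun_prop)
    have : Measurable (fun z : Rn n × ℝ => ENNReal.ofReal (z.2 ^ (q - 1))) := by fun_prop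
    exact this.indicator hs
  have mf : Measurable (Function.uncurry fun (t : ℝ) (x : Rn n) =>
      ENNReal.ofReal (t ^ (b - 1)) * Set.indicator {x | ENNReal.ofReal (t ^ (q / p)) < f x} f x) := by
    have hs : MeasurableSet {z : ℝ × Rn n | ENNReal.ofReal (z.1 ^ (q / p)) < f z.2} :=
      measurableSet_lt (by fun_prop) (by fun_prop)
    have h1 : Measurable (fun z : ℝ × Rn n => f z.2) := by fun_prop
    have h2 : Measurable (fun z : ℝ × Rn n => ENNReal.ofReal (z.1 ^ (b - 1))) := by fun_prop
    exact h2.mul (h1.indicator hs)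
  simp_rw [e1]
  rw [lintegral_const_mul' _ _ ENNReal.ofReal_ne_top, lintegral_lintegral_swap mT.aemeasurable]
  have e2 : ∀ t ∈ Set.Ioi (0:ℝ), (∫⁻ x : Rn n,
      Set.indicator {t : ℝ | ENNReal.ofReal t < T x} (fun t => ENNReal.ofReal (t ^ (q - 1))) t) ≤
      ENNReal.ofReal c * ∫⁻ x, ENNReal.ofReal (t ^ (b - 1)) *
        Set.indicator {x | ENNReal.ofReal (t ^ (q / p)) < f x} f x := by
    intro t ht
    have ht : 0 < t := ht
    have e3 : ∀ x, Set.indicator {t : ℝ | ENNReal.ofReal t < T x} (fun t => ENNReal.ofReal (t ^ (q - 1))) t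
        = Set.indicator {x | ENNReal.ofReal t < T x} (fun _ => ENNReal.ofReal (t ^ (q - 1))) x := by
      intro x; simp only [Set.indicator, Set.mem_ofPred_eq]
    simp_rw [e3]
    rw [lintegral_indicator (measurableSet_lt measurable_const hT), setLIntegral_const,
      lintegral_const_mul' _ _ ENNReal.ofReal_ne_top]
    refine (mul_le_mul_right (H t ht) _).trans (le_of_eq ?_)
    rw [← mul_assoc, ← mul_assoc, ← ENNReal.ofReal_mul (by positivity), ← ENNReal.ofReal_mul hc]
    congr 2
    rw [show b - 1 = (q - 1) + -(q / p) by rw [hbdef]; ring, Real.rpow_add ht]; ring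
  have e4 := setLIntegral_mono' (μ := volume) measurableSet_Ioi e2
  refine (mul_le_mul_right e4 _).trans ?_
  rw [lintegral_const_mul' _ _ ENNReal.ofReal_ne_top, lintegral_lintegral_swap mf.aemeasurable]
  have e5 : ∀ x, (∫⁻ t in Set.Ioi (0:ℝ), ENNReal.ofReal (t ^ (b - 1)) *
        Set.indicator {x | ENNReal.ofReal (t ^ (q / p)) < f x} f x) = 
        f x ^ p / ENNReal.ofReal b := by
    intro x
    have : ∀ t ∈ Set.Ioi (0:ℝ), ENNReal.ofReal (t ^ (b - 1)) *
        Set.indicator {x | ENNReal.ofReal (t ^ (q / p)) < f x} f x = 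
        f x * Set.indicator {t : ℝ | ENNReal.ofReal t < f x ^ (p / q)}
          (fun t => ENNReal.ofReal (t ^ (b - 1))) t := by
      intro t ht
      have ht : 0 < t := ht
      have : ENNReal.ofReal (t ^ (q / p)) < f x ↔ ENNReal.ofReal t < f x ^ (p / q) := by
        rw [← ENNReal.ofReal_rpow_of_pos ht, ← ENNReal.rpow_lt_rpow_iff (z := p / q) (by positivity),
          ← ENNReal.rpow_mul]
        rw [show q / p * (p / q) = 1 by field_simp, ENNReal.rpow_one]
      simp only [Set.indicator, Set.mem_ofPred_eq, this]
      split_ifs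
      · rw [mul_comm]
      · simp
    rw [setLIntegral_congr_fun measurableSet_Ioi this, lintegral_const_mul, aux_layer b hb,
      ← mul_div_assoc, ← ENNReal.rpow_mul]
    · congr 1
      rw [show p / q * b = p - 1 by rw [hbdef]; field_simp]
      nth_rewrite 1 [← ENNReal.rpow_one (f x)]
      rw [← ENNReal.rpow_add_of_nonneg _ _ (by norm_num) (by linarith)]
      congr 1; ring
    · have hs : MeasurableSet {t : ℝ | ENNReal.ofReal t < f x ^ (p / q)} :=
        measurableSet_lt (by fun_prop) (by fun_prop)
      exact Measurable.indicator (by fun_prop) hs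
  simp_rw [e5, div_eq_mul_inv]
  rw [lintegral_mul_const' _ _ (by simpa using hb)]
  refine le_of_eq ?_
  rw [← mul_assoc, ← ENNReal.ofReal_mul hq.le, mul_comm (∫⁻ x, f x ^ p), ← mul_assoc,
    ← ENNReal.ofReal_inv_of_pos hb, ← ENNReal.ofReal_mul (by positivity)]

lemma conv_L1 {n : ℕ} (K f : Rn n → ℝ≥0∞) (hK : Measurable K) (hf : Measurable f) :
    ∫⁻ x, ∫⁻ y, K (x - y) * f y = (∫⁻ x, K x) * ∫⁻ y, f y := by
  rw [lintegral_lintegral_swap (by fun_prop)]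
  have : ∀ y, ∫⁻ x, K (x - y) * f y = (∫⁻ x, K x) * f y := by
    intro y
    rw [lintegral_mul_const _ (by fun_prop), lintegral_sub_right_eq_self]
  simp_rw [this]
  rw [lintegral_const_mul _ hf]

lemma hls_normalized {n : ℕ} (hn : 0 < n) (α : ℝ) (hα0 : 0 < α) (hαn : α < n) 
    (p q : ℝ) (hp : 1 < p) (hpn : p * α < n) (hq : 1 / q = 1 / p - α / n) :
    ∃ C : ℝ, 0 < C ∧ ∀ f : Rn n → ℝ≥0∞, Measurable f → ∫⁻ x, f x ^ p ≤ 1 →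
      ∫⁻ x, (∫⁻ y, ENNReal.ofReal (‖x - y‖ ^ (α - (n:ℝ))) * f y) ^ q ≤ ENNReal.ofReal C := by
  have hn' : (0:ℝ) < n := by exact_mod_cast hn
  have hp0 : 0 < p := by linarith
  have hq0 : 0 < q := by
    rw [← one_div_pos, hq, sub_pos, div_lt_div_iff₀ hn' hp0]; linarith
  have hqp : q / p = 1 + α * q / n := by
    have : q * (1 / q) = q * (1 / p - α / n) := by rw [hq]
    rw [mul_one_div_cancel hq0.ne'] at this
    rw [this]; ring
  obtain ⟨p', hpp'⟩ : ∃ p', p' = p / (p - 1) := ⟨_, rfl⟩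
  have hconj : p'.HolderConjugate p := by
    have := Real.HolderConjugate.conjExponent hp
    rw [Real.conjExponent, ← hpp'] at this
    exact this.symm
  have hp'0 : 0 < p' := hconj.pos
  have hinv : 1 / p' = 1 - 1 / p := by
    have := hconj.inv_add_inv_eq_one
    rw [one_div, one_div]; linarith
  set β := α - (n:ℝ) with hβ
  have hexp : β + n / p' = -(n / q) := by
    rw [div_eq_mul_one_div, hinv, div_eq_mul_one_div (n:ℝ) q, hq, hβ]; field_simp; ring
  have hβ' : β * p' + n < 0 := by
    have : β * p' + n = p' * (β + n / p') := by field_simp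
    rw [this, hexp]
    have : 0 < p' * (n / q) := by positivity
    linarith
  obtain ⟨c1, hc1, h1⟩ := kern_in hn β (by rw [hβ]; linarith)
  obtain ⟨c2, hc2, h2⟩ := kern_out hn (β * p') hβ'
  have hβn : β + n = α := by rw [hβ]; ring
  set c2' := c2 ^ (1 / p') with hc2'
  have hc2'0 : 0 ≤ c2' := by positivity
  set A := c1 + c2' + 1 with hA
  have hA0 : 0 < A := by positivity
  refine ⟨A ^ q * (q * (c1 + 1) / (q - q / p)), ?_, fun f hf hf1 => ?_⟩
  · have hb : 0 < q - q / p := by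
      rw [sub_pos, div_lt_iff₀ hp0]; nlinarith
    positivity
  set Kin : ℝ → Rn n → ℝ≥0∞ := fun R x => ENNReal.ofReal (Set.indicator (Set.Iic R) (fun y => y ^ β) ‖x‖)
    with hKin
  set Kout : ℝ → Rn n → ℝ≥0∞ := fun R x => ENNReal.ofReal (Set.indicator (Set.Ioi R) (fun y => y ^ β) ‖x‖)
    with hKout
  have mKin : ∀ R, Measurable (Kin R) := fun R => by
    have : Measurable (Set.indicator (Set.Iic R) (fun y : ℝ => y ^ β)) :=
      Measurable.indicator (by fun_prop) measurableSet_Iic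
    fun_prop
  have mKout : ∀ R, Measurable (Kout R) := fun R => by
    have : Measurable (Set.indicator (Set.Ioi R) (fun y : ℝ => y ^ β)) :=
      Measurable.indicator (by fun_prop) measurableSet_Ioi
    fun_prop
  have hsplit : ∀ R x, ENNReal.ofReal (‖x‖ ^ β) = Kin R x + Kout R x := by
    intro R x
    simp only [hKin, hKout, Set.indicator, Set.mem_Iic, Set.mem_Ioi]
    by_cases h : ‖x‖ ≤ R
    · simp [h, not_lt.2 h]
    · simp [h, not_le.1 h]
  set T : Rn n → ℝ≥0∞ := fun x => ∫⁻ y, ENNReal.ofReal (‖x - y‖ ^ β) * f y with hT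
  have mT : Measurable T := by
    apply Measurable.lintegral_prod_right
    fun_prop
  have hout : ∀ R x, 0 < R → ∫⁻ y, Kout R (x - y) * f y ≤ ENNReal.ofReal (c2' * R ^ (-(n / q))) := by
    intro R x hR
    have := ENNReal.lintegral_mul_le_Lp_mul_Lq volume hconj (f := fun y => Kout R (x - y)) (g := f)
      ((mKout R).comp (by fun_prop)).aemeasurable hf.aemeasurable
    refine this.trans ?_
    have h3 : (∫⁻ y, f y ^ p) ^ (1 / p) ≤ 1 := ENNReal.rpow_le_one hf1 (by positivity)
    refine (mul_le_of_le_one_right' h3).trans ?_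
    rw [lintegral_sub_left_eq_self (fun z => Kout R z ^ p') x]
    have h4 : ∀ z, Kout R z ^ p' = ENNReal.ofReal (Set.indicator (Set.Ioi R) (fun y => y ^ (β * p')) ‖z‖) := by
      intro z
      simp only [hKout, Set.indicator, Set.mem_Ioi]
      split_ifs with h
      · rw [ENNReal.ofReal_rpow_of_nonneg (by positivity) hp'0.le, Real.rpow_mul (norm_nonneg _)]
      · simp [hp'0]
    simp_rw [h4]
    refine (ENNReal.rpow_le_rpow (h2 R hR) (by positivity)).trans (le_of_eq ?_)
    rw [ENNReal.ofReal_rpow_of_nonneg (by positivity) (by positivity), Real.mul_rpow hc2 (by positivity),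
      ← Real.rpow_mul hR.le, ← hexp]
    congr 3
    field_simp
  have hmain : ∀ t : ℝ, 0 < t → volume {x | ENNReal.ofReal t < T x / ENNReal.ofReal A} ≤
      ENNReal.ofReal ((c1 + 1) * t ^ (-(q / p))) *
        ∫⁻ x, Set.indicator {x | ENNReal.ofReal (t ^ (q / p)) < f x} f x := by
    intro t ht
    set s := ENNReal.ofReal (t ^ (q / p)) with hs
    set R := t ^ (-(q / n)) with hR
    have hR0 : 0 < R := by positivity
    have hRn : R ^ (-(n / q)) = t := by
      rw [hR, ← Real.rpow_mul ht.le]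
      rw [show -(q / n) * -(n / q) = (1:ℝ) by field_simp, Real.rpow_one]
    have hRα : R ^ α = t ^ (1 - q / p) := by
      rw [hR, ← Real.rpow_mul ht.le, hqp]
      congr 1; ring
    set f1 := Set.indicator {x | s < f x} f with hf1d
    have mf1 : Measurable f1 := hf.indicator (measurableSet_lt measurable_const hf)
    have hin := h1 R hR0
    rw [hβn, hRα] at hin
    set g : Rn n → ℝ≥0∞ := fun x => ∫⁻ y, Kin R (x - y) * f1 y with hg
    have mg : Measurable g := by
      apply Measurable.lintegral_prod_right
      have := mKin R
      fun_prop
    have hTle : ∀ x, T x ≤ ENNReal.ofReal ((c1 + c2') * t) + g x := by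
      intro x
      have ha : ∀ y, ENNReal.ofReal (‖x - y‖ ^ β) * f y ≤
          Kout R (x - y) * f y + (Kin R (x - y) * s + Kin R (x - y) * f1 y) := by
        intro y
        rw [hsplit R, add_mul, add_comm, ← mul_add]
        gcongr
        simp only [hf1d, Set.indicator, Set.mem_ofPred_eq]
        split_ifs with h
        · exact le_add_self
        · rw [add_zero]; exact not_lt.1 h
      refine (lintegral_mono ha).trans ?_
      have m1 := mKin R
      have m2 := mKout R
      rw [lintegral_add_left (by fun_prop), lintegral_add_left (by fun_prop), ← add_assoc]
      gcongr ?_ + g x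
      rw [lintegral_mul_const _ (by fun_prop), lintegral_sub_left_eq_self (Kin R) x]
      refine (add_le_add (hout R x hR0) (mul_le_mul_left hin s)).trans (le_of_eq ?_)
      rw [hRn, hs, ← ENNReal.ofReal_mul (by positivity), ← ENNReal.ofReal_add (by positivity) (by positivity),
        mul_assoc, ← Real.rpow_add ht]
      congr 1
      rw [sub_add_cancel, Real.rpow_one]; ring
    have hsub : {x | ENNReal.ofReal t < T x / ENNReal.ofReal A} ⊆ {x | ENNReal.ofReal t ≤ g x} := by
      intro x hx
      simp only [Set.mem_ofPred_eq] at hx ⊢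
      rw [ENNReal.lt_div_iff_mul_lt (Or.inl (by simpa using hA0)) (Or.inl ENNReal.ofReal_ne_top),
        ← ENNReal.ofReal_mul ht.le, show t * A = (c1 + c2') * t + t by rw [hA]; ring,
        ENNReal.ofReal_add (by positivity) ht.le] at hx
      exact ((ENNReal.add_lt_add_iff_left ENNReal.ofReal_ne_top).1 (hx.trans_le (hTle x))).le
    refine (measure_mono hsub).trans ?_
    refine (meas_ge_le_lintegral_div mg.aemeasurable (by simpa using ht) ENNReal.ofReal_ne_top).trans ?_
    rw [hg, conv_L1 (Kin R) f1 (mKin R) mf1]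
    rw [mul_comm, mul_div_assoc, mul_comm]
    refine mul_le_mul_left ?_ _
    rw [ENNReal.div_le_iff (by simpa using ht) ENNReal.ofReal_ne_top]
    refine hin.trans ?_
    rw [← ENNReal.ofReal_mul (by positivity)]
    apply ENNReal.ofReal_le_ofReal
    rw [sub_eq_add_neg, add_comm, Real.rpow_add ht, Real.rpow_one, ← mul_assoc]
    gcongr
    linarith
  have hfin := marcin_aux p q (c1 + 1) hp hq0 (by positivity) (fun x => T x / ENNReal.ofReal A) f
    (by fun_prop) hf hmain
  have e : ∀ x, T x ^ q = ENNReal.ofReal (A ^ q) * (T x / ENNReal.ofReal A) ^ q := by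
    intro x
    rw [← ENNReal.ofReal_rpow_of_pos hA0, ← ENNReal.mul_rpow_of_nonneg _ _ hq0.le,
      ENNReal.mul_div_cancel (by simpa using hA0) ENNReal.ofReal_ne_top]
  change ∫⁻ x, T x ^ q ≤ _
  rw [lintegral_congr e, lintegral_const_mul' _ _ ENNReal.ofReal_ne_top, ENNReal.ofReal_mul (by positivity)]
  gcongr
  refine hfin.trans ?_
  exact mul_le_of_le_one_right' hf1

lemma hls {n : ℕ} (hn : 0 < n) (α : ℝ) (hα0 : 0 < α) (hαn : α < n) 
    (p q : ℝ) (hp : 1 < p) (hpn : p * α < n) (hq : 1 / q = 1 / p - α / n) :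
    ∃ C : ℝ, 0 < C ∧ ∀ f : Rn n → ℝ, Measurable f → 
      eLpNorm (riesz α f) (ENNReal.ofReal q) volume ≤
        ENNReal.ofReal C * eLpNorm f (ENNReal.ofReal p) volume := by
  have hn' : (0:ℝ) < n := by exact_mod_cast hn
  have hp0 : 0 < p := by linarith
  have hq0 : 0 < q := by
    rw [← one_div_pos, hq, sub_pos, div_lt_div_iff₀ hn' hp0]; linarith
  obtain ⟨C, hC, h⟩ := hls_normalized hn α hα0 hαn p q hp hpn hq
  refine ⟨C ^ (1 / q), by positivity, fun f hf => ?_⟩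
  set N := eLpNorm f (ENNReal.ofReal p) volume with hN
  have hNe : N = (∫⁻ x, ‖f x‖ₑ ^ p) ^ (1 / p) := by
    rw [hN, eLpNorm_eq_lintegral_rpow_enorm_toReal (by simpa using hp0) ENNReal.ofReal_ne_top,
      ENNReal.toReal_ofReal hp0.le]
  rcases eq_or_ne N ⊤ with hNt | hNt
  · rw [hNt, ENNReal.mul_top]
    · exact le_top
    · have : 0 < C ^ (1 / q) := by positivity
      simpa using this
  have hb : ∀ x, ‖riesz α f x‖ₑ ≤ ∫⁻ y, ENNReal.ofReal (‖x - y‖ ^ (α - (n:ℝ))) * ‖f y‖ₑ := by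
    intro x
    refine (enorm_integral_le_lintegral_enorm _).trans (le_of_eq ?_)
    refine lintegral_congr fun y => ?_
    rw [enorm_mul, Real.enorm_of_nonneg (by positivity)]
  rcases eq_or_ne N 0 with hN0 | hN0
  · have hz : f =ᵐ[volume] 0 := by
      rwa [hN, eLpNorm_eq_zero_iff hf.aestronglyMeasurable (by simpa using hp0)] at hN0
    have : riesz α f = 0 := by
      funext x
      have : (fun y => ‖x - y‖ ^ (α - (n:ℝ)) * f y) =ᵐ[volume] 0 := by
        filter_upwards [hz] with y hy
        simp [hy]
      simp only [riesz, Pi.zero_apply]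
      rw [integral_congr_ae this]; simp
    rw [this]; simp
  have hg := h (fun y => ‖f y‖ₑ / N) (by fun_prop) (by
    simp_rw [ENNReal.div_rpow_of_nonneg _ _ hp0.le, div_eq_mul_inv]
    rw [lintegral_mul_const' _ _ (by simp [hp0.le, hN0, hp0])]
    have : N ^ p = ∫⁻ x, ‖f x‖ₑ ^ p := by
      rw [hNe, ← ENNReal.rpow_mul, one_div_mul_cancel hp0.ne', ENNReal.rpow_one]
    rw [← this]
    exact ENNReal.mul_inv_le_one _)
  rw [eLpNorm_eq_lintegral_rpow_enorm_toReal (by simpa using hq0) ENNReal.ofReal_ne_top,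
      ENNReal.toReal_ofReal hq0.le]
  have hpt : ∀ x, ‖riesz α f x‖ₑ ^ q ≤ 
     N ^ q * (∫⁻ y, ENNReal.ofReal (‖x - y‖ ^ (α - (n:ℝ))) * (‖f y‖ₑ / N)) ^ q := by
    intro x
    rw [← ENNReal.mul_rpow_of_nonneg _ _ hq0.le, ← lintegral_const_mul' _ _ hNt]
    refine ENNReal.rpow_le_rpow ((hb x).trans (le_of_eq (lintegral_congr fun y => ?_))) hq0.le
    rw [mul_left_comm, ENNReal.mul_div_cancel hN0 hNt]
  have hfin : ∫⁻ x, ‖riesz α f x‖ₑ ^ q ≤ N ^ q * ENNReal.ofReal C := by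
    refine (lintegral_mono hpt).trans ?_
    rw [lintegral_const_mul' _ _ (by simp [hq0.le, hNt])]
    gcongr
  refine (ENNReal.rpow_le_rpow hfin (by positivity)).trans (le_of_eq ?_)
  rw [ENNReal.mul_rpow_of_nonneg _ _ (by positivity), ← ENNReal.rpow_mul, mul_one_div_cancel hq0.ne',
    ENNReal.rpow_one, ENNReal.ofReal_rpow_of_pos hC, mul_comm]

lemma cube_eq {n : ℕ} (z : Rn n) {r : ℝ} (hr : 0 < r) :
    cube z r = WithLp.ofLp ⁻¹' (Metric.closedBall (WithLp.ofLp z : Fin n → ℝ) (r / 2)) := by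
  ext x
  simp only [cube, Set.mem_ofPred_eq, Set.mem_preimage, Metric.mem_closedBall]
  rw [dist_pi_le_iff (by positivity)]
  rfl

lemma cube_meas {n : ℕ} (z : Rn n) {r : ℝ} (hr : 0 < r) : MeasurableSet (cube z r) := by
  rw [cube_eq z hr]
  exact (PiLp.volume_preserving_ofLp (Fin n)).measurable Metric.isClosed_closedBall.measurableSet

lemma cube_vol {n : ℕ} (z : Rn n) {r : ℝ} (hr : 0 < r) :
    volume (cube z r) = ENNReal.ofReal (r ^ n) := by
  rw [cube_eq z hr, (PiLp.volume_preserving_ofLp (Fin n)).measure_preimage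
    Metric.isClosed_closedBall.measurableSet.nullMeasurableSet,
    Real.volume_pi_closedBall _ (by positivity)]
  simp [mul_div_cancel₀]

lemma transfer_aux (n : ℕ) (pm pp W K s t l L : ℝ) (hpm : 0 < pm) (hs : pm ≤ s) (hs' : s ≤ pp)
    (ht : pm ≤ t) (ht' : t ≤ pp) (hW : 0 ≤ W) (h : n * L - W ≤ s * l) (hK : |s - t| * |L| ≤ K) :
    n * L - (W + (n * K + pp * W) / pm) ≤ t * l := by
  have hs0 : 0 < s := by linarith
  have h1 : t * l = (t / s) * (s * l) := by field_simp
  have h2 : (t / s) * (n * L - W) ≤ (t / s) * (s * l) := by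
    apply mul_le_mul_of_nonneg_left h
    apply div_nonneg <;> linarith
  have h3 : (t / s) * (n * L - W) = (n * L - W) + (t - s) * (n * L - W) / s := by field_simp; ring
  have h4 : |(t - s) * (n * L - W)| ≤ n * K + pp * W := by
    rw [abs_mul, abs_sub_comm t s]
    have : |n * L - W| ≤ n * |L| + W := by
      refine (abs_sub _ _).trans ?_
      rw [abs_mul, abs_of_nonneg hW, Nat.abs_cast]
    have h5 : |s - t| ≤ pp := by rw [abs_le]; constructor <;> linarith
    have hn : (0:ℝ) ≤ n := Nat.cast_nonneg n
    calc |s - t| * |n * L - W| ≤ |s - t| * (n * |L| + W) := by gcongr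
      _ = n * (|s - t| * |L|) + |s - t| * W := by ring
      _ ≤ _ := by gcongr
  have h5 : |(t - s) * (n * L - W) / s| ≤ (n * K + pp * W) / pm := by
    rw [abs_div, abs_of_pos hs0]
    have : 0 ≤ n * K + pp * W := (abs_nonneg _).trans h4
    gcongr
  have := (abs_le.1 h5).1
  linarith

lemma good_aux (n : ℕ) (hn : 0 < n) (α p q qq W l L : ℝ) (hα : 0 < α) 
    (hq0 : 0 < q) (hqq : q ≤ qq) (hpq : q = p + α * p * q / n) (hW : 0 ≤ W)
    (h : n * L - W ≤ p * l) :
    Real.exp (-q * (l - α * L)) ≤ Real.exp (α * qq / n * W) * Real.exp (-p * l) := by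
  have hn' : (0:ℝ) < n := by exact_mod_cast hn
  rw [← Real.exp_add, Real.exp_le_exp]
  have h1 : -q * (l - α * L) = -p * l + α * q / n * (n * L - p * l) := by
    have : q * l = p * l + α * p * q / n * l := by
      nth_rewrite 1 [hpq]; ring
    field_simp at this ⊢
    linarith
  have h2 : α * q / n * (n * L - p * l) ≤ α * q / n * W := by
    apply mul_le_mul_of_nonneg_left (by linarith); positivity
  have h3 : α * q / n * W ≤ α * qq / n * W := by gcongr
  linarith

lemma mean_aux {n : ℕ} (p : Rn n → ℝ) (l v : ℝ) (hv : 0 < v) (F Q : Set (Rn n)) 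
    (hF : MeasurableSet F) (hFQ : F ⊆ Q) (hvol : volume F = ENNReal.ofReal v)
    (h : ∫⁻ x, Q.indicator (fun x => ENNReal.ofReal (Real.exp (-p x * l))) x ≤ 1) :
    ∃ y ∈ F, Real.log v - Real.log 2 ≤ p y * l := by
  by_contra! hcon
  have h1 : ∫⁻ x, F.indicator (fun _ => ENNReal.ofReal (2 / v)) x ≤ 1 := by
    refine le_trans (lintegral_mono fun x => ?_) h
    by_cases hx : x ∈ F
    · rw [Set.indicator_of_mem hx, Set.indicator_of_mem (hFQ hx)]
      apply ENNReal.ofReal_le_ofReal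
      have := hcon x hx
      rw [← Real.exp_log (show 0 < 2 / v by positivity), Real.exp_le_exp,
        Real.log_div (by norm_num) hv.ne']
      linarith
    · rw [Set.indicator_of_notMem hx]; exact zero_le
  rw [lintegral_indicator hF, setLIntegral_const, hvol, ← ENNReal.ofReal_mul (by positivity),
    div_mul_cancel₀ _ hv.ne', ENNReal.ofReal_le_one] at h1
  norm_num at h1

lemma cube_diam {n : ℕ} (z x y : Rn n) (r : ℝ) (hr : 0 < r) (hx : x ∈ cube z r) (hy : y ∈ cube z r) :
    ‖x - y‖ ≤ Real.sqrt n * r := by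
  rw [EuclideanSpace.norm_eq]
  have : ∀ i, ‖(x - y) i‖ ^ 2 ≤ r ^ 2 := by
    intro i
    have h1 := hx i
    have h2 := hy i
    rw [abs_le] at h1 h2
    rw [Real.norm_eq_abs, sq_abs, PiLp.sub_apply]
    apply sq_le_sq'  <;> linarith
  calc Real.sqrt (∑ i, ‖(x - y) i‖ ^ 2) ≤ Real.sqrt (∑ i : Fin n, r ^ 2) :=
        Real.sqrt_le_sqrt (Finset.sum_le_sum fun i _ => this i)
    _ = Real.sqrt n * r := by
      simp [Real.sqrt_mul, Real.sqrt_sq hr.le]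

lemma core_small {n : ℕ} (hn : 0 < n) (α : ℝ) (hα0 : 0 < α)
    (p q : Rn n → ℝ) (hploc : LogHolderLocal p)
    (pm pp qq : ℝ) (hpm : 0 < pm) (hpmle : ∀ x, pm ≤ p x) (hple : ∀ x, p x ≤ pp)
    (hq0 : ∀ x, 0 < q x) (hqq : ∀ x, q x ≤ qq) (hpq : ∀ x, q x = p x + α * p x * q x / n) :
    ∃ K : ℝ, 0 ≤ K ∧ ∀ (z : Rn n) (r l : ℝ), 0 < r → Real.sqrt n * r < 1 / 2 → 
      ∫⁻ x, (cube z r).indicator (fun x => ENNReal.ofReal (Real.exp (-p x * l))) x ≤ 1 →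
      ∫⁻ x, (cube z r).indicator (fun x => ENNReal.ofReal (Real.exp (-q x * (l - α * Real.log r)))) x
        ≤ ENNReal.ofReal K := by
  obtain ⟨c, hc, hlog⟩ := hploc
  set s := Real.log (Real.sqrt n) with hs
  have hsn : 1 ≤ Real.sqrt n := by
    rw [Real.one_le_sqrt]; exact_mod_cast hn
  have hs0 : 0 ≤ s := Real.log_nonneg hsn
  have hl2 : 0 < Real.log 2 := Real.log_pos (by norm_num)
  set K1 := c * (1 + s / Real.log 2) with hK1
  have hK1' : 0 ≤ K1 := by positivity
  have hpp : 0 < pp := hpm.trans_le ((hpmle 0).trans (hple 0))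
  set W := Real.log 2 + (n * K1 + pp * Real.log 2) / pm with hW
  have hW0 : 0 ≤ W := by positivity
  refine ⟨Real.exp (α * qq / n * W), by positivity, fun z r l hr hr2 h => ?_⟩
  obtain ⟨y, hy, hyl⟩ := mean_aux p l (r ^ n) (by positivity) (cube z r) (cube z r) (cube_meas z hr) subset_rfl
    (cube_vol z hr) h
  rw [Real.log_pow] at hyl
  have hpt : ∀ x ∈ cube z r, Real.exp (-q x * (l - α * Real.log r)) ≤ 
      Real.exp (α * qq / n * W) * Real.exp (-p x * l) := by
    intro x hx
    refine good_aux n hn α (p x) (q x) qq W l _ hα0 (hq0 x) (hqq x) (hpq x) hW0 ?_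
    refine transfer_aux n pm pp _ K1 (p y) (p x) l _ hpm (hpmle y) (hple y) (hpmle x) (hple x) hl2.le hyl ?_
    rcases eq_or_ne x y with rfl | hxy
    · simpa using hK1'
    have hd := cube_diam z y x r hr hy hx
    have h1 := hlog y x (hd.trans_lt hr2)
    have hpos : 0 < ‖y - x‖ := norm_pos_iff.2 (sub_ne_zero.2 hxy.symm)
    have hD : Real.log (Real.sqrt n * r) = s + Real.log r := by
      rw [Real.log_mul (by positivity) hr.ne']
    have hle : Real.log ‖y - x‖ ≤ s + Real.log r := by
      rw [← hD]; exact Real.log_le_log hpos hd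
    have hlt : s + Real.log r ≤ - Real.log 2 := by
      rw [← hD, ← Real.log_inv]
      apply Real.log_le_log (by positivity)
      rw [← one_div]; exact hr2.le
    have habs : |Real.log r| = - Real.log r := abs_of_neg (by linarith)
    rw [habs]
    have h2 : |p y - p x| ≤ c / (-(s + Real.log r)) := by
      refine h1.trans ?_
      apply div_le_div_of_nonneg_left hc.le <;> linarith
    have hE : 0 < -(s + Real.log r) := by linarith
    calc |p y - p x| * -Real.log r ≤ c / (-(s + Real.log r)) * -Real.log r := by
          apply mul_le_mul_of_nonneg_right h2; linarith
      _ = c * (1 + s / (-(s + Real.log r))) := by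
          have := hE.ne'
          rw [div_mul_eq_mul_div, mul_div_assoc]
          congr 1
          rw [eq_comm, ← eq_sub_iff_add_eq', eq_comm, div_sub_one this]
          congr 1; ring
      _ ≤ K1 := by
          rw [hK1]
          have : s / (-(s + Real.log r)) ≤ s / Real.log 2 := by
            apply div_le_div_of_nonneg_left hs0 hl2; linarith
          gcongr
  calc _ ≤ ∫⁻ x, ENNReal.ofReal (Real.exp (α * qq / n * W)) * 
        (cube z r).indicator (fun x => ENNReal.ofReal (Real.exp (-p x * l))) x := by
        refine lintegral_mono fun x => ?_
        by_cases hx : x ∈ cube z r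
        · simp only [Set.indicator_of_mem hx]
          rw [← ENNReal.ofReal_mul (by positivity)]
          exact ENNReal.ofReal_le_ofReal (hpt x hx)
        · simp [Set.indicator_of_notMem hx]
    _ ≤ _ := by
      rw [lintegral_const_mul' _ _ ENNReal.ofReal_ne_top]
      exact mul_le_of_le_one_right' h

lemma pinf_bounds {n : ℕ} (hn : 0 < n) (p : Rn n → ℝ) (pm pp C P : ℝ) (hC : 0 < C)
    (hpmle : ∀ x, pm ≤ p x) (hple : ∀ x, p x ≤ pp)
    (h : ∀ x : Rn n, |p x - P| ≤ C / Real.log (Real.exp 1 + ‖x‖)) : pm ≤ P ∧ P ≤ pp := by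
  have key : ∀ δ > 0, ∃ x, |p x - P| ≤ δ := by
    intro δ hδ
    refine ⟨EuclideanSpace.single ⟨0, hn⟩ (Real.exp (C / δ)), (h _).trans ?_⟩
    rw [PiLp.norm_single, Real.norm_eq_abs, Real.abs_exp]
    have h1 : C / δ ≤ Real.log (Real.exp 1 + Real.exp (C / δ)) := by
      rw [Real.le_log_iff_exp_le (by positivity)]
      have := Real.exp_pos 1
      linarith
    have h2 : 0 < C / δ := by positivity
    rw [div_le_iff₀ (by linarith)]
    rw [div_le_iff₀ hδ] at h1
    linarith
  constructor
  · refine le_of_forall_pos_le_add fun δ hδ => ?_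
    obtain ⟨x, hx⟩ := key δ hδ
    rw [abs_le] at hx
    linarith [hpmle x]
  · refine le_of_forall_pos_le_add fun δ hδ => ?_
    obtain ⟨x, hx⟩ := key δ hδ
    rw [abs_le] at hx
    linarith [hple x]

lemma far_cube {n : ℕ} (hn : 0 < n) (z : Rn n) (r : ℝ) (hr : 0 < r) :
    ∃ w : Rn n, cube w (r / 4) ⊆ cube z r ∧ ∀ x ∈ cube w (r / 4), r / 4 ≤ ‖x‖ := by
  obtain ⟨s, hs, hz⟩ : ∃ s : ℝ, (s = 1 ∨ s = -1) ∧ 0 ≤ s * z ⟨0, hn⟩ := by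
    rcases le_total 0 (z ⟨0, hn⟩) with h | h
    · exact ⟨1, Or.inl rfl, by linarith⟩
    · exact ⟨-1, Or.inr rfl, by linarith⟩
  refine ⟨WithLp.toLp 2 (fun i => z i + s * (3 * r / 8)), fun x hx i => ?_, fun x hx => ?_⟩
  · have h := hx i
    simp only at h
    rw [abs_le] at h ⊢
    rcases hs with rfl | rfl <;> constructor <;> linarith
  · have h := hx ⟨0, hn⟩
    simp only at h
    refine le_trans ?_ (PiLp.norm_apply_le x ⟨0, hn⟩)
    rw [Real.norm_eq_abs]
    rw [abs_le] at h
    rcases hs with rfl | rfl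
    · refine le_trans ?_ (le_abs_self _); linarith
    · refine le_trans ?_ (neg_le_abs _); linarith

set_option maxHeartbeats 2000000 in
lemma core_large {n : ℕ} (hn : 0 < n) (α : ℝ) (hα0 : 0 < α)
    (p q : Rn n → ℝ) (hpinf : LogHolderInfty p)
    (pm pp qq : ℝ) (hpm : 0 < pm) (hpmle : ∀ x, pm ≤ p x) (hple : ∀ x, p x ≤ pp)
    (hpp : pp * α < n)
    (hq0 : ∀ x, 0 < q x) (hqq : ∀ x, q x ≤ qq) (hpq : ∀ x, q x = p x + α * p x * q x / n)
    (r0 : ℝ) (hr0 : 0 < r0) :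
    ∃ K : ℝ, 0 ≤ K ∧ ∀ (z : Rn n) (r l : ℝ), r0 ≤ r →
      ∫⁻ x, (cube z r).indicator (fun x => ENNReal.ofReal (Real.exp (-p x * l))) x ≤ 1 →
      ∫⁻ x, (cube z r).indicator (fun x => ENNReal.ofReal (Real.exp (-q x * (l - α * Real.log r)))) x
        ≤ ENNReal.ofReal K := by
  have hn' : (0:ℝ) < n := by exact_mod_cast hn
  obtain ⟨C, hC, P, hP⟩ := hpinf
  obtain ⟨hP1, hP2⟩ := pinf_bounds hn p pm pp C P hC hpmle hple hP
  have hP0 : 0 < P := by linarith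
  have hpp0 : 0 < pp := by linarith
  have hqq0 : 0 < qq := (hq0 0).trans_le (hqq 0)
  have hl2 : 0 < Real.log 2 := Real.log_pos (by norm_num)
  have hl4 : 0 < Real.log 4 := Real.log_pos (by norm_num)
  have he := Real.exp_pos 1
  set g := 1 / P - α / n with hg
  have hg0 : 0 < g := by
    rw [hg, sub_pos, div_lt_div_iff₀ hn' hP0]
    nlinarith
  set ε := pm * g with hε
  have hε0 : 0 < ε := by positivity
  set a := 1 + |Real.log r0| with ha
  have ha0 : 0 < a := by positivity
  set B := 1 + Real.exp 1 / r0 with hB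
  have hB1 : 1 ≤ B := by
    have : 0 < Real.exp 1 / r0 := by positivity
    linarith
  have hlB : 0 ≤ Real.log B := Real.log_nonneg hB1
  set W := n * Real.log 4 + Real.log 2 with hW
  have hW0 : 0 ≤ W := by positivity
  set K2 := C * a * (1 + Real.log 4) with hK2
  set W' := W + (n * K2 + pp * W) / pm with hW'
  have hW'0 : 0 ≤ W' := by positivity
  set K3 := C * a / ε with hK3
  set W'' := W' + (n * K3 + pp * W') / pm with hW''
  have hW''0 : 0 ≤ W'' := by positivity
  set G := n * Real.log B * g + W' / P with hG
  have hG0 : 0 ≤ G := by positivity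
  set V1 := (volume (Metric.ball (0 : Rn n) 1)).toReal with hV1
  have hV1' : volume (Metric.ball (0 : Rn n) 1) = ENNReal.ofReal V1 :=
    (ENNReal.ofReal_toReal measure_ball_lt_top.ne).symm
  have hV10 : 0 ≤ V1 := ENNReal.toReal_nonneg
  refine ⟨Real.exp (α * qq / n * W'') + Real.exp (qq * G) * V1, by positivity, fun z r l hr h => ?_⟩
  have hr1 : 0 < r := by linarith
  set L := Real.log r with hL
  set Λ := Real.log (Real.exp 1 + r) with hΛ
  have hΛ1 : 1 ≤ Λ := by
    rw [hΛ, Real.le_log_iff_exp_le (by positivity)]; linarith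
  have hLa : |L| ≤ a * Λ := by
    rw [abs_le]
    have h1 : Real.log r0 ≤ L := Real.log_le_log hr0 hr
    have h2 : L ≤ Λ := Real.log_le_log hr1 (by linarith)
    have h3 := neg_abs_le (Real.log r0)
    have h4 : |Real.log r0| ≤ |Real.log r0| * Λ := le_mul_of_one_le_right (abs_nonneg _) hΛ1
    have h5 : 0 ≤ |Real.log r0| := abs_nonneg _
    rw [ha, add_mul]
    constructor <;> nlinarith
  have hLB : Λ - Real.log B ≤ L := by
    have : Λ ≤ Real.log (B * r) := by
      apply Real.log_le_log (by positivity)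
      have : Real.exp 1 ≤ Real.exp 1 / r0 * r := by
        rw [div_mul_eq_mul_div, le_div_iff₀ hr0]; gcongr
      rw [hB, add_mul]; linarith
    rw [Real.log_mul (by positivity) hr1.ne'] at this
    linarith
  have hfar : ∀ x κ, 0 < κ → κ * Λ ≤ Real.log (Real.exp 1 + ‖x‖) → |p x - P| * |L| ≤ C * a / κ := by
    intro x κ hκ hx
    have h1 : 0 < κ * Λ := by positivity
    calc |p x - P| * |L| ≤ (C / (κ * Λ)) * (a * Λ) := by
          gcongr
          refine (hP x).trans ?_
          gcongr
      _ = C * a / κ := by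
          field_simp
  obtain ⟨w, hw1, hw2⟩ := far_cube hn z r hr1
  obtain ⟨y, hy, hyl⟩ := mean_aux p l ((r / 4) ^ n) (by positivity) _ _ (cube_meas w (by positivity)) hw1
    (cube_vol w (by positivity)) h
  rw [Real.log_pow, Real.log_div hr1.ne' (by norm_num)] at hyl
  have hPl : n * L - W' ≤ P * l := by
    refine transfer_aux n pm pp _ K2 (p y) P l _ hpm (hpmle y) (hple y) hP1 hP2 hW0 
      (by rw [hW]; linarith) ?_
    have := hfar y (1 / (1 + Real.log 4)) (by positivity) (by
      rw [div_mul_eq_mul_div, one_mul, div_le_iff₀ (by positivity)]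
      have h1 : Λ ≤ Real.log (4 * (Real.exp 1 + ‖y‖)) := by
        apply Real.log_le_log (by positivity)
        have := hw2 y hy
        linarith
      rw [Real.log_mul (by norm_num) (by positivity)] at h1
      have h2 : 1 ≤ Real.log (Real.exp 1 + ‖y‖) := by
        rw [Real.le_log_iff_exp_le (by positivity)]
        have := norm_nonneg y
        linarith
      nlinarith)
    refine this.trans (le_of_eq ?_)
    rw [hK2]; field_simp
  set ρ := Real.exp (ε * Λ) with hρ
  have hpt1 : ∀ x, ε * Λ ≤ Real.log (Real.exp 1 + ‖x‖) → Real.exp (-q x * (l - α * L)) ≤ 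
      Real.exp (α * qq / n * W'') * Real.exp (-p x * l) := by
    intro x hx
    refine good_aux n hn α (p x) (q x) qq W'' l _ hα0 (hq0 x) (hqq x) (hpq x) hW''0 ?_
    refine transfer_aux n pm pp _ K3 P (p x) l _ hpm hP1 hP2 (hpmle x) (hple x) hW'0 hPl ?_
    rw [abs_sub_comm]
    exact hfar x ε hε0 hx
  have hpt2 : ∀ x, Real.exp (-q x * (l - α * L)) ≤ Real.exp (qq * G) * Real.exp (-(n * (ε * Λ))) := by
    intro x
    rw [← Real.exp_add, Real.exp_le_exp]
    have h1 : (n * L - W') / P ≤ l := by rw [div_le_iff₀ hP0]; linarith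
    have h2 : (n * L - W') / P - α * L = n * g * L - W' / P := by
      rw [hg]; field_simp; ring
    have h3 : n * g * (Λ - Real.log B) ≤ n * g * L := by gcongr
    have h4 : n * g * Λ - G ≤ l - α * L := by
      rw [hG]; linarith
    have h5 : q x * (n * g * Λ - G) ≤ q x * (l - α * L) := mul_le_mul_of_nonneg_left h4 (hq0 x).le
    have h6 : q x * G ≤ qq * G := mul_le_mul_of_nonneg_right (hqq x) hG0
    have hqp : pm ≤ q x := by
      have : 0 ≤ α * p x * q x / n := by
        have := hq0 x
        have := hpm.trans_le (hpmle x)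
        positivity
      linarith [hpq x, hpmle x]
    have h7 : pm * (n * g * Λ) ≤ q x * (n * g * Λ) := by gcongr
    rw [hε]
    linarith
  calc _ ≤ ∫⁻ x, (ENNReal.ofReal (Real.exp (α * qq / n * W'')) * 
        (cube z r).indicator (fun x => ENNReal.ofReal (Real.exp (-p x * l))) x + 
        (Metric.ball (0 : Rn n) ρ).indicator (fun _ => 
          ENNReal.ofReal (Real.exp (qq * G) * Real.exp (-(n * (ε * Λ))))) x) := by
        refine lintegral_mono fun x => ?_
        by_cases hx : x ∈ cube z r
        · simp only [Set.indicator_of_mem hx]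
          by_cases hx2 : ε * Λ ≤ Real.log (Real.exp 1 + ‖x‖)
          · rw [← ENNReal.ofReal_mul (by positivity)]
            exact (ENNReal.ofReal_le_ofReal (hpt1 x hx2)).trans le_self_add
          · have : x ∈ Metric.ball (0 : Rn n) ρ := by
              rw [mem_ball_zero_iff, hρ]
              rw [not_le, Real.log_lt_iff_lt_exp (by positivity)] at hx2
              linarith
            rw [Set.indicator_of_mem this]
            exact (ENNReal.ofReal_le_ofReal (hpt2 x)).trans le_add_self
        · simp [Set.indicator_of_notMem hx]
    _ ≤ _ := by
      rw [lintegral_add_right _ (measurable_const.indicator measurableSet_ball),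
        lintegral_const_mul' _ _ ENNReal.ofReal_ne_top, lintegral_indicator measurableSet_ball,
        setLIntegral_const, ENNReal.ofReal_add (by positivity) (by positivity)]
      refine add_le_add (mul_le_of_le_one_right' h) (le_of_eq ?_)
      rw [Measure.addHaar_ball_of_pos _ _ (Real.exp_pos _), hV1', finrank_euclideanSpace_fin,
        ← ENNReal.ofReal_mul (by positivity), ← ENNReal.ofReal_mul (by positivity)]
      congr 1
      rw [← Real.exp_nat_mul, Real.exp_neg]
      field_simp

lemma modular_eq {n : ℕ} (p : Rn n → ℝ) (hp : ∀ x, 0 < p x) (z : Rn n) (r lam : ℝ) (hl : 0 < lam) :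
    ∫⁻ x, (ENNReal.ofReal |cubeInd z r x| / ENNReal.ofReal lam) ^ (p x) =
    ∫⁻ x, (cube z r).indicator (fun x => ENNReal.ofReal (Real.exp (-p x * Real.log lam))) x := by
  refine lintegral_congr fun x => ?_
  by_cases hx : x ∈ cube z r
  · simp only [cubeInd, Set.indicator_of_mem hx, Pi.one_apply, abs_one]
    rw [← ENNReal.ofReal_div_of_pos hl, ENNReal.ofReal_rpow_of_pos (by positivity),
      Real.rpow_def_of_pos (by positivity), Real.log_div one_ne_zero hl.ne', Real.log_one]
    congr 2; ring
  · simp [cubeInd, Set.indicator_of_notMem hx, hp x]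

lemma norm_compare {n : ℕ} (hn : 0 < n) (α : ℝ) (hα0 : 0 < α)
    (p q : Rn n → ℝ) (hploc : LogHolderLocal p) (hpinf : LogHolderInfty p)
    (pm pp : ℝ) (hpm : 0 < pm) (hpmle : ∀ x, pm ≤ p x) (hple : ∀ x, p x ≤ pp)
    (hpp : pp * α < n)
    (hq : ∀ x, 1 / q x = 1 / p x - α / n) :
    ∃ C : ℝ, 0 < C ∧ ∀ (z : Rn n) (r : ℝ), 0 < r →
      varLpNorm q (cubeInd z r) ≤ ENNReal.ofReal (C * r ^ (-α)) * varLpNorm p (cubeInd z r) := by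
  have hn' : (0:ℝ) < n := by exact_mod_cast hn
  have hp0 : ∀ x, 0 < p x := fun x => hpm.trans_le (hpmle x)
  have hpp0 : 0 < pp := (hp0 0).trans_le (hple 0)
  have hg : 0 < 1 / pp - α / n := by
    rw [sub_pos, div_lt_div_iff₀ hn' hpp0]; linarith
  have hge : ∀ x, 1 / pp - α / n ≤ 1 / q x := fun x => by
    rw [hq]
    have := one_div_le_one_div_of_le (hp0 x) (hple x)
    linarith
  have hq0 : ∀ x, 0 < q x := fun x => by
    rw [← one_div_pos]; exact hg.trans_le (hge x)
  have hqq : ∀ x, q x ≤ 1 / (1 / pp - α / n) := fun x => by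
    rw [le_one_div (hq0 x) hg]; exact hge x
  have hpq : ∀ x, q x = p x + α * p x * q x / n := fun x => by
    have := hq x
    have h1 := (hq0 x).ne'
    have h2 := (hp0 x).ne'
    field_simp at this ⊢
    linarith
  have hqm : ∀ x, pm ≤ q x := fun x => by
    have : 0 ≤ α * p x * q x / n := by
      have := hq0 x
      have := hp0 x
      positivity
    linarith [hpq x, hpmle x]
  have hsn : 0 < Real.sqrt n := Real.sqrt_pos.2 hn'
  obtain ⟨K1, hK1, h1⟩ := core_small hn α hα0 p q hploc pm pp _ hpm hpmle hple hq0 hqq hpq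
  obtain ⟨K2, hK2, h2⟩ := core_large hn α hα0 p q hpinf pm pp _ hpm hpmle hple hpp hq0 hqq hpq
    (1 / (2 * Real.sqrt n)) (by positivity)
  set K := 1 + K1 + K2 with hK
  have hK1' : 1 ≤ K := by linarith
  have hlK : 0 ≤ Real.log K := Real.log_nonneg hK1'
  have hcore : ∀ (z : Rn n) (r l : ℝ), 0 < r →
      ∫⁻ x, (cube z r).indicator (fun x => ENNReal.ofReal (Real.exp (-p x * l))) x ≤ 1 →
      ∫⁻ x, (cube z r).indicator (fun x => ENNReal.ofReal (Real.exp (-q x * (l - α * Real.log r)))) x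
        ≤ ENNReal.ofReal K := by
    intro z r l hr h
    by_cases hs : Real.sqrt n * r < 1 / 2
    · exact (h1 z r l hr hs h).trans (ENNReal.ofReal_le_ofReal (by linarith))
    · refine (h2 z r l ?_ h).trans (ENNReal.ofReal_le_ofReal (by linarith))
      rw [div_le_iff₀ (by positivity)]
      linarith
  refine ⟨Real.exp (Real.log K / pm), by positivity, fun z r hr => ?_⟩
  set k := Real.exp (Real.log K / pm) * r ^ (-α) with hk
  have hk0 : 0 < k := by positivity
  have hlogk : Real.log k = Real.log K / pm - α * Real.log r := by
    rw [hk, Real.log_mul (by positivity) (by positivity), Real.log_exp, Real.log_rpow hr]; ring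
  rw [mul_comm, ← ENNReal.div_le_iff (by simpa using hk0) ENNReal.ofReal_ne_top]
  unfold varLpNorm varLpNormE
  refine le_sInf ?_
  rintro _ ⟨lam, hl, rfl, hmod⟩
  rw [ENNReal.div_le_iff (by simpa using hk0) ENNReal.ofReal_ne_top]
  refine sInf_le ⟨lam * k, by positivity, by rw [ENNReal.ofReal_mul hl.le], ?_⟩
  rw [modular_eq p hp0 z r lam hl] at hmod
  rw [modular_eq q hq0 z r _ (by positivity), Real.log_mul hl.ne' hk0.ne', hlogk]
  have := hcore z r _ hr hmod
  calc _ ≤ ∫⁻ x, ENNReal.ofReal K⁻¹ * (cube z r).indicator 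
        (fun x => ENNReal.ofReal (Real.exp (-q x * (Real.log lam - α * Real.log r)))) x := by
        refine lintegral_mono fun x => ?_
        by_cases hx : x ∈ cube z r
        · simp only [Set.indicator_of_mem hx]
          rw [← ENNReal.ofReal_mul (by positivity)]
          apply ENNReal.ofReal_le_ofReal
          rw [← Real.exp_log (show 0 < K⁻¹ by positivity), ← Real.exp_add, Real.exp_le_exp, Real.log_inv]
          have : Real.log K ≤ q x * (Real.log K / pm) := by
            rw [mul_div_assoc', le_div_iff₀ hpm, mul_comm]
            exact mul_le_mul_of_nonneg_right (hqm x) hlK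
          linarith
        · simp [Set.indicator_of_notMem hx]
    _ ≤ ENNReal.ofReal K⁻¹ * ENNReal.ofReal K := by
      rw [lintegral_const_mul' _ _ ENNReal.ofReal_ne_top]
      gcongr
    _ = 1 := by
      rw [← ENNReal.ofReal_mul (by positivity), inv_mul_cancel₀ (by positivity), ENNReal.ofReal_one]

theorem riesz_atom_local_Lq0_bound
    {n : ℕ} (hn : 0 < n)
    (α : ℝ) (hα0 : 0 < α) (hαn : α < n)
    (p q : Rn n → ℝ) (hploc : LogHolderLocal p) (hpinf : LogHolderInfty p)
    (pm pp : ℝ) (hpm : 0 < pm) (hpmle : ∀ x, pm ≤ p x) (hple : ∀ x, p x ≤ pp)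
    (hpp : pp * α < n)
    (hq : ∀ x, 1 / q x = 1 / p x - α / n)
    (p₀ q₀ : ℝ) (hp₀1 : 1 < p₀) (hp₀p : pp < p₀) (hp₀n : p₀ * α < n)
    (hq₀ : 1 / q₀ = 1 / p₀ - α / n)
    (d : ℕ) (hd : dIndex n (pLow p) ≤ d) :
    ∃ C > 0, ∀ (a : Rn n → ℝ) (z : Rn n) (r : ℝ), 0 < r → IsPAtom p p₀ d a z r →
      eLpNorm (riesz α a) (ENNReal.ofReal q₀)
          (volume.restrict (cube z (2 * Real.sqrt n * r))) ≤
        ENNReal.ofReal (C * (volume (cube z r)).toReal ^ (1 / q₀)) /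
          varLpNorm q (cubeInd z r) := by
  have hn' : (0:ℝ) < n := by exact_mod_cast hn
  obtain ⟨C1, hC1, h1⟩ := hls hn α hα0 hαn p₀ q₀ hp₀1 hp₀n hq₀
  obtain ⟨C2, hC2, h2⟩ := norm_compare hn α hα0 p q hploc hpinf pm pp hpm hpmle hple hpp hq
  refine ⟨C1 * C2, by positivity, fun a z r hr ha => ?_⟩
  refine (eLpNorm_mono_measure _ Measure.restrict_le_self).trans ?_
  refine (h1 a ha.measurable).trans ?_
  refine (mul_le_mul_right ha.size _).trans ?_
  have hV : (volume (cube z r)).toReal = r ^ n := by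
    rw [cube_vol z hr, ENNReal.toReal_ofReal (by positivity)]
  rw [hV]
  have h3 := h2 z r hr
  set Nq := varLpNorm q (cubeInd z r)
  set Np := varLpNorm p (cubeInd z r)
  have hk0 : 0 < C2 * r ^ (-α) := by positivity
  have h4 : Np⁻¹ ≤ ENNReal.ofReal (C2 * r ^ (-α)) * Nq⁻¹ := by
    have h5 := ENNReal.inv_le_inv.2 h3
    rw [ENNReal.mul_inv (Or.inl (by simpa using hk0)) (Or.inl ENNReal.ofReal_ne_top)] at h5
    calc Np⁻¹ = ENNReal.ofReal (C2 * r ^ (-α)) * ((ENNReal.ofReal (C2 * r ^ (-α)))⁻¹ * Np⁻¹) := by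
          rw [← mul_assoc, ENNReal.mul_inv_cancel (by simpa using hk0) ENNReal.ofReal_ne_top, one_mul]
      _ ≤ _ := by gcongr
  rw [div_eq_mul_inv (ENNReal.ofReal ((r ^ n) ^ (1 / p₀))), div_eq_mul_inv _ Nq]
  calc _ ≤ ENNReal.ofReal C1 * (ENNReal.ofReal ((r ^ n) ^ (1 / p₀)) * 
        (ENNReal.ofReal (C2 * r ^ (-α)) * Nq⁻¹)) := by
        exact mul_le_mul_right (mul_le_mul_right h4 _) _
    _ = _ := by
      rw [← mul_assoc, ← mul_assoc, ← ENNReal.ofReal_mul hC1.le, ← ENNReal.ofReal_mul (by positivity)]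
      congr 2
      have : (r ^ n : ℝ) ^ (1 / q₀) = (r ^ n) ^ (1 / p₀) * r ^ (-α) := by
        rw [hq₀, sub_eq_add_neg, Real.rpow_add (by positivity)]
        congr 1
        rw [← Real.rpow_natCast, ← Real.rpow_mul hr.le]
        congr 1
        field_simp
      rw [this]; ring
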